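/- For the two-trader hamiltonian H, the portfolio operator Π̂₁ = P̂ n̂₁ + k̂₁, and the number state φ = φ_{n₁,n₂;k₁,k₂;O;M}, the first-order term of the Heisenberg expansion of the mean portfolio vanishes and the second-order term equals t²·n₁·(O − M); that is, ⟨φ, [H, Π̂₁] φ⟩ = 0 and −½·⟨φ, [H, [H, Π̂₁]] φ⟩ = n₁·(O − M), where [A,B] = AB − BA. Hence up to second order in t, Π₁(t) = Π₁(0) + t²·n₁·(O − M). -/

import Mathlib

/- Context: the two-trader stock market with dynamical price. V is the free
complex vector space with orthonormal basis {φ_{n₁,n₂;k₁,k₂;O;m}}, realized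
as finitely supported functions Idx2 →₀ ℂ. -/

noncomputable section

/-- The basis index: shares n₁,n₂, cash k₁,k₂, supply O, price m. -/
structure Idx2 where
  n1 : ℕ
  n2 : ℕ
  k1 : ℕ
  k2 : ℕ
  O : ℕ
  m : ℕ
deriving DecidableEq

abbrev V2 := Idx2 →₀ ℂ

/-- Generic bosonic annihilation operator on the coordinate described by
`get`/`set`: φ ↦ √(index) · (φ with index lowered by one). -/
def ann (get : Idx2 → ℕ) (set : Idx2 → ℕ → Idx2) : Module.End ℂ V2 :=
  Finsupp.lift _ ℂ Idx2 fun i =>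
    Finsupp.single (set i (get i - 1)) ((Real.sqrt (get i) : ℝ) : ℂ)

/-- Generic bosonic creation operator on the coordinate described by
`get`/`set`: φ ↦ √(index+1) · (φ with index raised by one). -/
def cre (get : Idx2 → ℕ) (set : Idx2 → ℕ → Idx2) : Module.End ℂ V2 :=
  Finsupp.lift _ ℂ Idx2 fun i =>
    Finsupp.single (set i (get i + 1)) ((Real.sqrt (get i + 1) : ℝ) : ℂ)

def a1 : Module.End ℂ V2 := ann (·.n1) (fun i v => { i with n1 := v })
def a1dag : Module.End ℂ V2 := cre (·.n1) (fun i v => { i with n1 := v })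
def a2 : Module.End ℂ V2 := ann (·.n2) (fun i v => { i with n2 := v })
def a2dag : Module.End ℂ V2 := cre (·.n2) (fun i v => { i with n2 := v })
def c1 : Module.End ℂ V2 := ann (·.k1) (fun i v => { i with k1 := v })
def c1dag : Module.End ℂ V2 := cre (·.k1) (fun i v => { i with k1 := v })
def c2 : Module.End ℂ V2 := ann (·.k2) (fun i v => { i with k2 := v })
def c2dag : Module.End ℂ V2 := cre (·.k2) (fun i v => { i with k2 := v })
def oOp : Module.End ℂ V2 := ann (·.O) (fun i v => { i with O := v })
def odag : Module.End ℂ V2 := cre (·.O) (fun i v => { i with O := v })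
def pOp : Module.End ℂ V2 := ann (·.m) (fun i v => { i with m := v })
def pdag : Module.End ℂ V2 := cre (·.m) (fun i v => { i with m := v })

def n1hat : Module.End ℂ V2 := a1dag * a1
def n2hat : Module.End ℂ V2 := a2dag * a2
def k1hat : Module.End ℂ V2 := c1dag * c1
def k2hat : Module.End ℂ V2 := c2dag * c2
def Omegahat : Module.End ℂ V2 := odag * oOp
def Phat : Module.End ℂ V2 := pdag * pOp

/-- The operator c_j^P̂ : φ ↦ φ if m = 0; 0 if m > k_j;
√(k_j(k_j−1)⋯(k_j−m+1)) · (φ with k_j ↦ k_j−m) if 0 < m ≤ k_j. -/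
def lowerPow (getk : Idx2 → ℕ) (setk : Idx2 → ℕ → Idx2) : Module.End ℂ V2 :=
  Finsupp.lift _ ℂ Idx2 fun i =>
    if i.m ≤ getk i then
      Finsupp.single (setk i (getk i - i.m))
        ((Real.sqrt (∏ j ∈ Finset.range i.m, ((getk i : ℝ) - j)) : ℝ) : ℂ)
    else 0

/-- The operator (c_j†)^P̂ : φ ↦ φ if m = 0;
√((k_j+1)⋯(k_j+m)) · (φ with k_j ↦ k_j+m) if m > 0. -/
def raisePow (getk : Idx2 → ℕ) (setk : Idx2 → ℕ → Idx2) : Module.End ℂ V2 :=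
  Finsupp.lift _ ℂ Idx2 fun i =>
    Finsupp.single (setk i (getk i + i.m))
      ((Real.sqrt (∏ j ∈ Finset.range i.m, ((getk i : ℝ) + j + 1)) : ℝ) : ℂ)

def c1PowP : Module.End ℂ V2 := lowerPow (·.k1) (fun i v => { i with k1 := v })
def c1dagPowP : Module.End ℂ V2 := raisePow (·.k1) (fun i v => { i with k1 := v })
def c2PowP : Module.End ℂ V2 := lowerPow (·.k2) (fun i v => { i with k2 := v })
def c2dagPowP : Module.End ℂ V2 := raisePow (·.k2) (fun i v => { i with k2 := v })

/-- The two-trader hamiltonian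
H = α₁n̂₁ + α₂n̂₂ + β₁k̂₁ + β₂k̂₂ + o†o + p†p
  + ( a₁†a₂ c₁^P̂ (c₂†)^P̂ + a₁a₂† (c₁†)^P̂ c₂^P̂ ) + (o†p + p†o). -/
def Ham2 (α1 α2 β1 β2 : ℝ) : Module.End ℂ V2 :=
  ((α1 : ℂ) • n1hat + (α2 : ℂ) • n2hat + (β1 : ℂ) • k1hat + (β2 : ℂ) • k2hat)
    + odag * oOp + pdag * pOp
    + (a1dag * a2 * c1PowP * c2dagPowP + a1 * a2dag * c1dagPowP * c2PowP)
    + (odag * pOp + pdag * oOp)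

/-- The commutator [A,B] = AB − BA. -/
def opComm (A B : Module.End ℂ V2) : Module.End ℂ V2 := A * B - B * A

/-- The basis vector φ_{n₁,n₂;k₁,k₂;O;m}. -/
def phi (n1 n2 k1 k2 O m : ℕ) : V2 := Finsupp.single ⟨n1, n2, k1, k2, O, m⟩ 1

/-- The inner product making the basis orthonormal (antilinear in the first slot). -/
def inn (x y : V2) : ℂ := x.sum fun i a => (starRingEnd ℂ) a * y i

theorem ann_single (get : Idx2 → ℕ) (set : Idx2 → ℕ → Idx2) (i : Idx2) (c : ℂ) :
    ann get set (Finsupp.single i c) =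
      Finsupp.single (set i (get i - 1)) (c * ((Real.sqrt (get i) : ℝ) : ℂ)) := by
  simp [ann]

theorem cre_single (get : Idx2 → ℕ) (set : Idx2 → ℕ → Idx2) (i : Idx2) (c : ℂ) :
    cre get set (Finsupp.single i c) =
      Finsupp.single (set i (get i + 1)) (c * ((Real.sqrt (get i + 1) : ℝ) : ℂ)) := by
  simp [cre]

theorem lowerPow_single (getk : Idx2 → ℕ) (setk : Idx2 → ℕ → Idx2) (i : Idx2) (c : ℂ) :
    lowerPow getk setk (Finsupp.single i c) =
      if i.m ≤ getk i then
        Finsupp.single (setk i (getk i - i.m))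
          (c * ((Real.sqrt (∏ j ∈ Finset.range i.m, ((getk i : ℝ) - j)) : ℝ) : ℂ))
      else 0 := by
  by_cases h : i.m ≤ getk i <;> simp [lowerPow, h]

theorem raisePow_single (getk : Idx2 → ℕ) (setk : Idx2 → ℕ → Idx2) (i : Idx2) (c : ℂ) :
    raisePow getk setk (Finsupp.single i c) =
      Finsupp.single (setk i (getk i + i.m))
        (c * ((Real.sqrt (∏ j ∈ Finset.range i.m, ((getk i : ℝ) + j + 1)) : ℝ) : ℂ)) := by
  simp [raisePow]

/-- Matrix elements against a number state are coordinates. -/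
theorem inn_phi (n1 n2 k1 k2 O m : ℕ) (v : V2) :
    inn (phi n1 n2 k1 k2 O m) v = v ⟨n1, n2, k1, k2, O, m⟩ := by
  simp [inn, phi]

theorem ofReal_sqrt_mul_self {x : ℝ} (hx : 0 ≤ x) :
    ((Real.sqrt x : ℝ) : ℂ) * ((Real.sqrt x : ℝ) : ℂ) = (x : ℂ) := by
  rw [← Complex.ofReal_mul, Real.mul_self_sqrt hx]

/-- A number operator is diagonal. -/
theorem cre_mul_ann_single (get : Idx2 → ℕ) (set : Idx2 → ℕ → Idx2)
    (hget : ∀ i v, get (set i v) = v) (hset : ∀ i v w, set (set i v) w = set i w)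
    (hself : ∀ i, set i (get i) = i) (i : Idx2) (c : ℂ) :
    (cre get set * ann get set) (Finsupp.single i c) = Finsupp.single i (get i * c) := by
  rw [Module.End.mul_apply, ann_single, cre_single, hget, hset]
  rcases Nat.eq_zero_or_pos (get i) with h | h
  · simp [h]
  · have hcast : ((get i - 1 : ℕ) : ℝ) + 1 = get i := by
      exact_mod_cast Nat.sub_add_cancel h
    rw [Nat.sub_add_cancel h, hself, hcast, mul_assoc,
      ofReal_sqrt_mul_self (Nat.cast_nonneg _), mul_comm, Complex.ofReal_natCast]

theorem n1hat_single (i : Idx2) (c : ℂ) :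
    n1hat (Finsupp.single i c) = Finsupp.single i (i.n1 * c) := by
  rw [n1hat, a1dag, a1, cre_mul_ann_single] <;> intros <;> rfl

theorem n2hat_single (i : Idx2) (c : ℂ) :
    n2hat (Finsupp.single i c) = Finsupp.single i (i.n2 * c) := by
  rw [n2hat, a2dag, a2, cre_mul_ann_single] <;> intros <;> rfl

theorem k1hat_single (i : Idx2) (c : ℂ) :
    k1hat (Finsupp.single i c) = Finsupp.single i (i.k1 * c) := by
  rw [k1hat, c1dag, c1, cre_mul_ann_single] <;> intros <;> rfl

theorem k2hat_single (i : Idx2) (c : ℂ) :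
    k2hat (Finsupp.single i c) = Finsupp.single i (i.k2 * c) := by
  rw [k2hat, c2dag, c2, cre_mul_ann_single] <;> intros <;> rfl

theorem Omegahat_single (i : Idx2) (c : ℂ) :
    Omegahat (Finsupp.single i c) = Finsupp.single i (i.O * c) := by
  rw [Omegahat, odag, oOp, cre_mul_ann_single] <;> intros <;> rfl

theorem Phat_single (i : Idx2) (c : ℂ) :
    Phat (Finsupp.single i c) = Finsupp.single i (i.m * c) := by
  rw [Phat, pdag, pOp, cre_mul_ann_single] <;> intros <;> rfl

/-- The portfolio operator is diagonal. -/
theorem portfolio_single (i : Idx2) (c : ℂ) :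
    (Phat * n1hat + k1hat) (Finsupp.single i c) =
      Finsupp.single i ((i.m * i.n1 + i.k1) * c) := by
  rw [LinearMap.add_apply, Module.End.mul_apply, n1hat_single, Phat_single, k1hat_single,
    ← Finsupp.single_add]
  ring_nf

/-- The diagonal part of the hamiltonian. -/
def freeEnergy (α1 α2 β1 β2 : ℝ) (i : Idx2) : ℂ :=
  α1 * i.n1 + α2 * i.n2 + β1 * i.k1 + β2 * i.k2 + i.O + i.m

/-- The amplitude with which trader 1 buys a share from trader 2. -/
def buyAmp (i : Idx2) : ℂ :=
  Real.sqrt (∏ j ∈ Finset.range i.m, ((i.k2 : ℝ) + j + 1)) *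
    Real.sqrt (∏ j ∈ Finset.range i.m, ((i.k1 : ℝ) - j)) *
    Real.sqrt i.n2 * Real.sqrt (i.n1 + 1)

/-- The amplitude with which trader 1 sells a share to trader 2. -/
def sellAmp (i : Idx2) : ℂ :=
  Real.sqrt (∏ j ∈ Finset.range i.m, ((i.k2 : ℝ) - j)) *
    Real.sqrt (∏ j ∈ Finset.range i.m, ((i.k1 : ℝ) + j + 1)) *
    Real.sqrt (i.n2 + 1) * Real.sqrt i.n1

theorem Ham2_single (α1 α2 β1 β2 : ℝ) (i : Idx2) (c : ℂ) :
    Ham2 α1 α2 β1 β2 (Finsupp.single i c) =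
      Finsupp.single i (c * freeEnergy α1 α2 β1 β2 i)
      + ((if i.m ≤ i.k1 then
            Finsupp.single ⟨i.n1 + 1, i.n2 - 1, i.k1 - i.m, i.k2 + i.m, i.O, i.m⟩ (c * buyAmp i)
          else 0)
        + (if i.m ≤ i.k2 then
            Finsupp.single ⟨i.n1 - 1, i.n2 + 1, i.k1 + i.m, i.k2 - i.m, i.O, i.m⟩ (c * sellAmp i)
          else 0))
      + (Finsupp.single ⟨i.n1, i.n2, i.k1, i.k2, i.O + 1, i.m - 1⟩
            (c * (Real.sqrt i.m * Real.sqrt (i.O + 1)))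
        + Finsupp.single ⟨i.n1, i.n2, i.k1, i.k2, i.O - 1, i.m + 1⟩
            (c * (Real.sqrt i.O * Real.sqrt (i.m + 1)))) := by
  have hO : odag * oOp = Omegahat := rfl
  have hP : pdag * pOp = Phat := rfl
  rw [Ham2, hO, hP]
  simp only [LinearMap.add_apply, LinearMap.smul_apply, n1hat_single, n2hat_single,
    k1hat_single, k2hat_single, Omegahat_single, Phat_single]
  congr 1
  · congr 1
    · simp only [Finsupp.smul_single, ← Finsupp.single_add, smul_eq_mul, freeEnergy]
      congr 1
      ring
    · congr 1
      · simp only [Module.End.mul_apply, a1dag, a2, c1PowP, c2dagPowP, raisePow_single,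
          lowerPow_single]
        split_ifs
        · simp only [ann_single, cre_single, buyAmp, mul_assoc]
        · simp
      · simp only [Module.End.mul_apply, a1, a2dag, c1dagPowP, c2PowP, lowerPow_single]
        split_ifs
        · simp only [raisePow_single, ann_single, cre_single, sellAmp, mul_assoc]
        · simp
  · simp only [Module.End.mul_apply, odag, pOp, pdag, oOp, ann_single, cre_single, mul_assoc]

/-- Trades conserve the portfolio, so only the price dynamics contributes to its commutator
with the hamiltonian. -/
theorem opComm_Ham2_portfolio_single (α1 α2 β1 β2 : ℝ) (i : Idx2) (c : ℂ) :
    opComm (Ham2 α1 α2 β1 β2) (Phat * n1hat + k1hat) (Finsupp.single i c) =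
      Finsupp.single ⟨i.n1, i.n2, i.k1, i.k2, i.O + 1, i.m - 1⟩
          (c * i.n1 * (Real.sqrt i.m * Real.sqrt (i.O + 1)))
        - Finsupp.single ⟨i.n1, i.n2, i.k1, i.k2, i.O - 1, i.m + 1⟩
          (c * i.n1 * (Real.sqrt i.O * Real.sqrt (i.m + 1))) := by
  obtain ⟨n1, n2, k1, k2, O, m⟩ := i
  have hbuy : (Phat * n1hat + k1hat)
      (if m ≤ k1 then Finsupp.single ⟨n1 + 1, n2 - 1, k1 - m, k2 + m, O, m⟩
        (c * buyAmp ⟨n1, n2, k1, k2, O, m⟩) else 0) =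
      if m ≤ k1 then Finsupp.single ⟨n1 + 1, n2 - 1, k1 - m, k2 + m, O, m⟩
        ((m * n1 + k1) * c * buyAmp ⟨n1, n2, k1, k2, O, m⟩) else 0 := by
    split_ifs with h
    · rw [portfolio_single]
      push_cast [Nat.cast_sub h]
      ring_nf
    · simp
  have hsell : (Phat * n1hat + k1hat)
      (if m ≤ k2 then Finsupp.single ⟨n1 - 1, n2 + 1, k1 + m, k2 - m, O, m⟩
        (c * sellAmp ⟨n1, n2, k1, k2, O, m⟩) else 0) =
      if m ≤ k2 then Finsupp.single ⟨n1 - 1, n2 + 1, k1 + m, k2 - m, O, m⟩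
        ((m * n1 + k1) * c * sellAmp ⟨n1, n2, k1, k2, O, m⟩) else 0 := by
    split_ifs with h
    · rw [portfolio_single]
      cases n1 with
      | zero => simp [sellAmp]
      | succ n =>
        push_cast [Nat.add_sub_cancel]
        ring_nf
    · simp
  have hdown : (Phat * n1hat + k1hat)
      (Finsupp.single ⟨n1, n2, k1, k2, O + 1, m - 1⟩
        (c * (Real.sqrt m * Real.sqrt (O + 1)))) =
      Finsupp.single ⟨n1, n2, k1, k2, O + 1, m - 1⟩
        ((m * n1 + k1 - n1) * c * (Real.sqrt m * Real.sqrt (O + 1))) := by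
    rw [portfolio_single]
    cases m with
    | zero => simp
    | succ m =>
      push_cast [Nat.add_sub_cancel]
      ring_nf
  rw [opComm, LinearMap.sub_apply, Module.End.mul_apply, Module.End.mul_apply,
    portfolio_single, Ham2_single, Ham2_single]
  simp only [map_add, hbuy, hsell, hdown]
  rw [portfolio_single, portfolio_single]
  ext j
  by_cases h1 : m ≤ k1 <;> by_cases h2 : m ≤ k2 <;>
    simp only [h1, h2, if_true, if_false, Finsupp.add_apply, Finsupp.sub_apply,
      Finsupp.single_apply, Finsupp.zero_apply] <;>
    split_ifs <;> push_cast <;> ring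

/-- Only the price dynamics changes the supply. -/
theorem Ham2_single_apply_of_O_ne (α1 α2 β1 β2 : ℝ) {i j : Idx2} (h : i.O ≠ j.O) (c : ℂ) :
    Ham2 α1 α2 β1 β2 (Finsupp.single i c) j =
      Finsupp.single (⟨i.n1, i.n2, i.k1, i.k2, i.O + 1, i.m - 1⟩ : Idx2)
            (c * (Real.sqrt i.m * Real.sqrt (i.O + 1))) j
        + Finsupp.single (⟨i.n1, i.n2, i.k1, i.k2, i.O - 1, i.m + 1⟩ : Idx2)
            (c * (Real.sqrt i.O * Real.sqrt (i.m + 1))) j := by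
  have hne (n1 n2 k1 k2 m : ℕ) (d : ℂ) :
      Finsupp.single (⟨n1, n2, k1, k2, i.O, m⟩ : Idx2) d j = 0 :=
    Finsupp.single_eq_of_ne fun e => h (congrArg Idx2.O e).symm
  rw [Ham2_single]
  simp only [Finsupp.add_apply, hne i.n1 i.n2 i.k1 i.k2 i.m]
  split_ifs <;> simp [hne]

theorem opComm_Ham2_portfolio_single_apply_of_O_eq (α1 α2 β1 β2 : ℝ) {i j : Idx2}
    (h : i.O = j.O) (c : ℂ) :
    opComm (Ham2 α1 α2 β1 β2) (Phat * n1hat + k1hat) (Finsupp.single i c) j = 0 := by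
  have hne (O m : ℕ) (d : ℂ) (hO : O ≠ j.O) :
      Finsupp.single (⟨i.n1, i.n2, i.k1, i.k2, O, m⟩ : Idx2) d j = 0 :=
    Finsupp.single_eq_of_ne fun e => hO (congrArg Idx2.O e).symm
  rw [opComm_Ham2_portfolio_single, Finsupp.sub_apply, hne _ _ _ (by omega)]
  rcases Nat.eq_zero_or_pos i.O with h0 | h0
  · simp [h0]
  · rw [hne _ _ _ (by omega), sub_zero]

/-- for the portfolio Π̂₁ = P̂ n̂₁ + k̂₁ and the number state
φ = φ_{n₁,n₂;k₁,k₂;O;M}, the first-order term of the Heisenberg expansion of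
the mean portfolio vanishes, ⟨φ, [H,Π̂₁]φ⟩ = 0, and the second-order term is
−½⟨φ, [H,[H,Π̂₁]]φ⟩ = n₁(O − M); hence Π₁(t) = Π₁(0) + t²·n₁·(O−M) up to
second order in t. -/
theorem portfolio_second_order_expansion (α1 α2 β1 β2 : ℝ) (n1 n2 k1 k2 O M : ℕ) :
    inn (phi n1 n2 k1 k2 O M)
        (opComm (Ham2 α1 α2 β1 β2) (Phat * n1hat + k1hat) (phi n1 n2 k1 k2 O M)) = 0 ∧
    -(1/2 : ℂ) * inn (phi n1 n2 k1 k2 O M)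
        (opComm (Ham2 α1 α2 β1 β2)
          (opComm (Ham2 α1 α2 β1 β2) (Phat * n1hat + k1hat)) (phi n1 n2 k1 k2 O M))
      = (n1 : ℂ) * ((O : ℂ) - (M : ℂ)) := by
  rw [inn_phi, inn_phi]
  refine ⟨opComm_Ham2_portfolio_single_apply_of_O_eq _ _ _ _ rfl _, ?_⟩
  have hYH : opComm (Ham2 α1 α2 β1 β2) (Phat * n1hat + k1hat)
        (Ham2 α1 α2 β1 β2 (phi n1 n2 k1 k2 O M)) ⟨n1, n2, k1, k2, O, M⟩ =
      opComm (Ham2 α1 α2 β1 β2) (Phat * n1hat + k1hat)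
        (Finsupp.single (⟨n1, n2, k1, k2, O + 1, M - 1⟩ : Idx2)
            (Real.sqrt M * Real.sqrt (O + 1) : ℂ) +
          Finsupp.single (⟨n1, n2, k1, k2, O - 1, M + 1⟩ : Idx2)
            (Real.sqrt O * Real.sqrt (M + 1) : ℂ))
        ⟨n1, n2, k1, k2, O, M⟩ := by
    rw [phi, Ham2_single]
    simp only [map_add, Finsupp.add_apply, one_mul]
    split_ifs <;> simp [opComm_Ham2_portfolio_single_apply_of_O_eq]
  have hdown : ((Real.sqrt M : ℝ) * (Real.sqrt (O + 1) : ℝ)) ^ 2 = (M * (O + 1) : ℂ) := by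
    rw [mul_pow, sq, sq, ofReal_sqrt_mul_self (by positivity),
      ofReal_sqrt_mul_self (by positivity)]
    push_cast
    rfl
  have hup : ((Real.sqrt O : ℝ) * (Real.sqrt (M + 1) : ℝ)) ^ 2 = (O * (M + 1) : ℂ) := by
    rw [mul_pow, sq, sq, ofReal_sqrt_mul_self (by positivity),
      ofReal_sqrt_mul_self (by positivity)]
    push_cast
    rfl
  rw [opComm, LinearMap.sub_apply, Finsupp.sub_apply, Module.End.mul_apply,
    Module.End.mul_apply, hYH, phi, opComm_Ham2_portfolio_single, map_sub, map_add,
    opComm_Ham2_portfolio_single, opComm_Ham2_portfolio_single]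
  rcases O with _ | O <;> rcases M with _ | M <;>
    simp [Ham2_single_apply_of_O_ne, -Finsupp.single_mul] at hdown hup ⊢
  · linear_combination -(n1 : ℂ) * hdown
  · linear_combination (n1 : ℂ) * hup
  · linear_combination (n1 : ℂ) * hup - (n1 : ℂ) * hdown

end
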